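/- Let d ≥ 2 and M ≥ N ≥ 0 be integers. The minimum global (Bayesian) mean square error for estimating the squared overlap c under the prior p_d(c) = (d−1)(1−c)^{d−2} using the measurement statistics q_{N,M} is given exactly by: ∫_0^1 (d−1)(1−c)^{d−2}·c² dc − Σ_{j=0}^{N} [∫_0^1 c·(d−1)(1−c)^{d−2}·q_{N,M}(j,c) dc]² / [∫_0^1 (d−1)(1−c)^{d−2}·q_{N,M}(j,c) dc] = (d−1)(d+M+N) / (d(d+1)(d+M)(d+N)). -/

import Mathlib

open Finset intervalIntegral

/-- The outcome distribution `q_{N,M}(j,c)` of the optimal (weak Schur sampling)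
measurement for estimating the squared overlap `c`, given `N` and `M ≥ N` copies. -/
noncomputable def overlapDist (N M j : ℕ) (c : ℝ) : ℝ :=
  (((M - N + 2 * j + 1) * Nat.factorial N * Nat.factorial M : ℕ) : ℝ) /
      ((Nat.factorial (N - j) * Nat.factorial (M + j + 1) : ℕ) : ℝ) *
    ∑ m ∈ Finset.range (M - N + j + 1),
      ((Nat.choose (M - N + j) m * Nat.choose (j + m) m : ℕ) : ℝ) * c ^ m * (1 - c) ^ (M - m)

open scoped Nat

/-- The Beta integral at natural parameters. -/
theorem integral_pow_mul_one_sub_pow (m n : ℕ) :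
    ∫ x in (0:ℝ)..1, x ^ m * (1 - x) ^ n = (m ! * n ! : ℝ) / (m + n + 1)! := by
  induction m generalizing n with
  | zero =>
    have h := integral_comp_sub_left (fun x : ℝ => x ^ n) (a := 0) (b := 1) 1
    simp only [pow_zero, one_mul, h, sub_self, sub_zero, integral_pow, zero_add]
    rw [Nat.factorial_succ]
    push_cast
    have := Nat.factorial_ne_zero n
    field_simp
    simp
  | succ m ih =>
    have hderiv (x : ℝ) : HasDerivAt (fun x : ℝ => x ^ (m + 1) * (1 - x) ^ (n + 1))
        ((m + 1) * (x ^ m * (1 - x) ^ (n + 1)) - (n + 1) * (x ^ (m + 1) * (1 - x) ^ n)) x := by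
      refine ((hasDerivAt_pow (m + 1) x).mul
        (((hasDerivAt_id' x).const_sub 1).pow (n + 1))).congr_deriv ?_
      simp
      ring
    have h := integral_eq_sub_of_hasDerivAt (a := 0) (b := 1) (fun x _ => hderiv x)
      (Continuous.intervalIntegrable (by fun_prop) _ _)
    rw [integral_sub (Continuous.intervalIntegrable (by fun_prop) _ _)
      (Continuous.intervalIntegrable (by fun_prop) _ _), integral_const_mul, integral_const_mul,
      ih (n + 1)] at h
    have hn : (n + 1 : ℝ) ≠ 0 := by positivity
    rw [← mul_right_inj' hn, show m + 1 + n + 1 = m + (n + 1) + 1 by ring]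
    simp only [Nat.factorial_succ m, Nat.factorial_succ n, Nat.cast_mul, Nat.cast_succ] at h ⊢
    simp at h
    linear_combination -h

/-- A Chu–Vandermonde identity in factorial form. -/
theorem sum_choose_mul_factorial_mul_factorial (K j B : ℕ) :
    ∑ p ∈ antidiagonal K, (K.choose p.1 : ℝ) * ((j + p.1)! * (B + p.2)!) =
      (j ! * B ! * (B + j + K + 1)! : ℝ) / (B + j + 1)! := by
  induction K generalizing j B with
  | zero =>
    have := Nat.factorial_ne_zero (B + j + 1)
    simp
    field_simp
  | succ K ih =>
    have hsymm : ∑ p ∈ antidiagonal K, (K.choose p.2 : ℝ) * ((j + (p.1 + 1))! * (B + p.2)!) =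
        ∑ p ∈ antidiagonal K, (K.choose p.1 : ℝ) * ((j + 1 + p.1)! * (B + p.2)!) := by
      refine sum_congr rfl fun p hp => ?_
      rw [Nat.choose_symm_of_eq_add (mem_antidiagonal.1 hp).symm, add_assoc, add_comm 1]
    have hshift (i : ℕ) : B + (i + 1) = B + 1 + i := by ring
    rw [sum_antidiagonal_choose_succ_mul (fun a b => ((j + a)! * (B + b)! : ℝ)), hsymm, ih,
      sum_congr rfl fun p _ => by rw [hshift p.2], ih,
      show B + (j + 1) + K + 1 = B + j + K + 2 by ring,
      show B + 1 + j + K + 1 = B + j + K + 2 by ring,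
      show B + j + (K + 1) + 1 = B + j + K + 2 by ring,
      show B + (j + 1) + 1 = B + j + 1 + 1 by ring, show B + 1 + j + 1 = B + j + 1 + 1 by ring,
      Nat.factorial_succ (B + j + 1), Nat.factorial_succ j, Nat.factorial_succ B]
    have := Nat.factorial_ne_zero (B + j + 1)
    push_cast
    field_simp
    ring

/-- The integral of `(1 - c) ^ e` against the outcome probability `q_{N,M}(j, c)`. -/
noncomputable def overlapWeight (e N M j : ℕ) : ℝ :=
  (M - N + 2 * j + 1 : ℝ) * N ! * M ! * (N - j + e)! * (M + j + e + 1)! /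
    ((N - j)! * (M + j + 1)! * (N + e + 1)! * (M + e + 1)!)

theorem continuous_overlapDist (N M j : ℕ) : Continuous (overlapDist N M j) := by
  unfold overlapDist
  fun_prop

theorem integral_one_sub_pow_mul_overlapDist {N M j : ℕ} (e : ℕ) (hNM : N ≤ M) (hj : j ≤ N) :
    ∫ c in (0:ℝ)..1, (1 - c) ^ e * overlapDist N M j c = overlapWeight e N M j := by
  obtain ⟨a, rfl⟩ := Nat.exists_eq_add_of_le hj
  obtain ⟨D, rfl⟩ := Nat.exists_eq_add_of_le hNM
  have hterm (c : ℝ) : (1 - c) ^ e * overlapDist (j + a) (j + a + D) j c =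
      ((D + 2 * j + 1 : ℝ) * (j + a)! * (j + a + D)! / (a ! * (j + a + D + j + 1)!)) *
        ∑ p ∈ antidiagonal (D + j), ((D + j).choose p.1 * (j + p.1).choose p.1 : ℝ) *
          (c ^ p.1 * (1 - c) ^ (a + e + p.2)) := by
    rw [overlapDist, Nat.add_sub_cancel_left, Nat.add_sub_cancel_left, mul_left_comm, mul_sum,
      ← Nat.succ_eq_add_one, Nat.sum_antidiagonal_eq_sum_range_succ_mk]
    push_cast
    congr 1
    refine sum_congr rfl fun m hm => ?_
    have hm' : m ≤ D + j := by simpa [Nat.lt_succ_iff] using hm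
    rw [show j + a + D - m = a + (D + j - m) by omega]
    ring
  have hchoose (m : ℕ) : ((j + m).choose m : ℝ) * m ! = (j + m)! / j ! := by
    have := Nat.factorial_ne_zero j
    have h := Nat.add_choose_mul_factorial_mul_factorial j m
    rw [eq_div_iff (by positivity), ← h]
    push_cast
    ring
  simp only [hterm]
  rw [integral_const_mul, integral_finsetSum
    fun p _ => Continuous.intervalIntegrable (by fun_prop) _ _]
  simp only [integral_const_mul, integral_pow_mul_one_sub_pow]
  have hsum : ∑ p ∈ antidiagonal (D + j), ((D + j).choose p.1 * (j + p.1).choose p.1 : ℝ) *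
      ((p.1 ! * (a + e + p.2)! : ℝ) / (p.1 + (a + e + p.2) + 1)!) =
      (∑ p ∈ antidiagonal (D + j), ((D + j).choose p.1 : ℝ) * ((j + p.1)! * (a + e + p.2)!)) /
        (j ! * (j + a + D + e + 1)!) := by
    rw [sum_div]
    refine sum_congr rfl fun p hp => ?_
    have hp' := mem_antidiagonal.1 hp
    rw [show p.1 + (a + e + p.2) + 1 = j + a + D + e + 1 by omega]
    linear_combination ((D + j).choose p.1 * (a + e + p.2)! / (j + a + D + e + 1)! : ℝ) *
      hchoose p.1
  rw [hsum, sum_choose_mul_factorial_mul_factorial, overlapWeight, Nat.add_sub_cancel_left,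
    show a + e + j + (D + j) + 1 = j + a + D + j + e + 1 by ring,
    show a + e + j + 1 = j + a + e + 1 by ring]
  have := Nat.factorial_ne_zero j
  push_cast
  field_simp
  ring

theorem sum_factorial_ratio (e N M : ℕ) :
    ∑ j ∈ range (N + 1), (M - N + 2 * j + 1 : ℝ) * (N - j + e)! * (M + j + e + 1)! /
      ((N - j)! * (M + j + 1)!) =
      ((N + e + 1)! * (M + e + 1)! : ℝ) / ((e + 1) * N ! * M !) := by
  induction N generalizing M with
  | zero =>
    have := Nat.factorial_ne_zero M
    simp [Nat.factorial_succ]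
    field_simp
  | succ N ih =>
    have hshift (j : ℕ) : (M - (N + 1 : ℕ) + 2 * (j + 1 : ℕ) + 1 : ℝ) *
        (N + 1 - (j + 1) + e)! * (M + (j + 1) + e + 1)! /
          ((N + 1 - (j + 1))! * (M + (j + 1) + 1)!) =
        ((M + 1 : ℕ) - N + 2 * j + 1 : ℝ) * (N - j + e)! * (M + 1 + j + e + 1)! /
          ((N - j)! * (M + 1 + j + 1)!) := by
      rw [Nat.add_sub_add_right, show M + (j + 1) = M + 1 + j by ring]
      push_cast
      ring
    rw [sum_range_succ', sum_congr rfl fun j _ => hshift j, ih]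
    simp only [Nat.sub_zero, add_zero]
    rw [show M + 1 + e + 1 = M + e + 1 + 1 by ring, show N + 1 + e = N + e + 1 by ring,
      Nat.factorial_succ (M + e + 1), Nat.factorial_succ (N + e + 1), Nat.factorial_succ N,
      Nat.factorial_succ M]
    have := Nat.factorial_ne_zero M
    have := Nat.factorial_ne_zero N
    push_cast
    field_simp
    ring

theorem sum_overlapWeight (e N M : ℕ) :
    ∑ j ∈ range (N + 1), overlapWeight e N M j = 1 / (e + 1) := by
  have h (j : ℕ) : overlapWeight e N M j = (N ! * M ! : ℝ) / ((N + e + 1)! * (M + e + 1)!) *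
      ((M - N + 2 * j + 1 : ℝ) * (N - j + e)! * (M + j + e + 1)! / ((N - j)! * (M + j + 1)!)) := by
    rw [overlapWeight]
    field_simp
  have := Nat.factorial_ne_zero M
  have := Nat.factorial_ne_zero N
  have := Nat.factorial_ne_zero (N + e + 1)
  have := Nat.factorial_ne_zero (M + e + 1)
  simp only [h]
  rw [← mul_sum, sum_factorial_ratio]
  field_simp

theorem overlapWeight_succ {N j : ℕ} (e M : ℕ) (hj : j ≤ N) :
    overlapWeight (e + 1) N M j =
      (N - j + e + 1 : ℝ) * (M + j + e + 2) / ((N + e + 2) * (M + e + 2)) *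
        overlapWeight e N M j := by
  obtain ⟨a, rfl⟩ := Nat.exists_eq_add_of_le hj
  rw [overlapWeight, overlapWeight, Nat.add_sub_cancel_left, ← add_assoc, ← add_assoc, ← add_assoc,
    ← add_assoc, Nat.factorial_succ (a + e), Nat.factorial_succ (M + j + e + 1),
    Nat.factorial_succ (j + a + e + 1), Nat.factorial_succ (M + e + 1)]
  push_cast
  field_simp
  ring

theorem overlapWeight_pos {N M j : ℕ} (e : ℕ) (hNM : N ≤ M) : 0 < overlapWeight e N M j := by
  have : (0 : ℝ) ≤ M - N := sub_nonneg.2 (by exact_mod_cast hNM)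
  unfold overlapWeight
  positivity

/-- The squared posterior mean times the marginal, as a combination of three weights. -/
theorem sq_sub_div_overlapWeight {N M j : ℕ} (e : ℕ) (hNM : N ≤ M) (hj : j ≤ N) :
    (overlapWeight e N M j - overlapWeight (e + 1) N M j) ^ 2 / overlapWeight e N M j =
      overlapWeight e N M j - 2 * overlapWeight (e + 1) N M j +
        ((N + e + 3) * (M + e + 3) * overlapWeight (e + 2) N M j -
          (M + N + 2 * e + 4) * overlapWeight (e + 1) N M j) / ((N + e + 2) * (M + e + 2)) := by
  have hW := (overlapWeight_pos (j := j) e hNM).ne'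
  rw [overlapWeight_succ (e + 1) M hj, overlapWeight_succ e M hj]
  push_cast
  field_simp
  ring

/-- For `d ≥ 2` and `M ≥ N ≥ 0`, the minimum global (Bayesian) mean square error for
estimating the squared overlap `c` under the prior `p_d(c) = (d−1)(1−c)^{d−2}` with
the measurement statistics `q_{N,M}` is exactly
`(d−1)(d+M+N)/(d(d+1)(d+M)(d+N))`. -/
theorem optimal_bayesian_mse (d N M : ℕ) (hd : 2 ≤ d) (hNM : N ≤ M) :
    (∫ c in (0:ℝ)..1, ((d : ℝ) - 1) * (1 - c) ^ (d - 2) * c ^ 2) -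
      ∑ j ∈ Finset.range (N + 1),
        (∫ c in (0:ℝ)..1, c * (((d : ℝ) - 1) * (1 - c) ^ (d - 2)) * overlapDist N M j c) ^ 2 /
          (∫ c in (0:ℝ)..1, ((d : ℝ) - 1) * (1 - c) ^ (d - 2) * overlapDist N M j c) =
    ((d : ℝ) - 1) * ((d : ℝ) + M + N) /
      ((d : ℝ) * ((d : ℝ) + 1) * ((d : ℝ) + M) * ((d : ℝ) + N)) := by
  obtain ⟨e, rfl⟩ := Nat.exists_eq_add_of_le' hd
  have hprior : ∫ c in (0:ℝ)..1, (((e + 2 : ℕ) : ℝ) - 1) * (1 - c) ^ (e + 2 - 2) * c ^ 2 =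
      2 / (((e : ℝ) + 2) * (e + 3)) := by
    have h (c : ℝ) : (((e + 2 : ℕ) : ℝ) - 1) * (1 - c) ^ (e + 2 - 2) * c ^ 2 =
        (e + 1) * (c ^ 2 * (1 - c) ^ e) := by
      rw [Nat.add_sub_cancel]
      push_cast
      ring
    simp only [h]
    rw [integral_const_mul, integral_pow_mul_one_sub_pow, show 2 + e + 1 = e + 1 + 1 + 1 by ring]
    simp only [Nat.factorial_succ]
    have := Nat.factorial_ne_zero e
    push_cast
    field_simp
    norm_num
    ring
  have hterm (j : ℕ) (hj : j ∈ range (N + 1)) :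
      (∫ c in (0:ℝ)..1, c * ((((e + 2 : ℕ) : ℝ) - 1) * (1 - c) ^ (e + 2 - 2)) *
          overlapDist N M j c) ^ 2 /
        (∫ c in (0:ℝ)..1, (((e + 2 : ℕ) : ℝ) - 1) * (1 - c) ^ (e + 2 - 2) *
          overlapDist N M j c) =
      (e + 1) * ((overlapWeight e N M j - overlapWeight (e + 1) N M j) ^ 2 /
        overlapWeight e N M j) := by
    have hj' : j ≤ N := Nat.lt_succ_iff.1 (mem_range.1 hj)
    have hcont := continuous_overlapDist N M j
    have hmarginal (c : ℝ) : (((e + 2 : ℕ) : ℝ) - 1) * (1 - c) ^ (e + 2 - 2) *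
        overlapDist N M j c = (e + 1) * ((1 - c) ^ e * overlapDist N M j c) := by
      rw [Nat.add_sub_cancel]
      push_cast
      ring
    have hmoment (c : ℝ) : c * ((((e + 2 : ℕ) : ℝ) - 1) * (1 - c) ^ (e + 2 - 2)) *
        overlapDist N M j c = (e + 1) * ((1 - c) ^ e * overlapDist N M j c -
          (1 - c) ^ (e + 1) * overlapDist N M j c) := by
      rw [Nat.add_sub_cancel]
      push_cast
      ring
    simp only [hmarginal, hmoment]
    rw [integral_const_mul, integral_const_mul,
      integral_sub (Continuous.intervalIntegrable (by fun_prop) _ _)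
        (Continuous.intervalIntegrable (by fun_prop) _ _),
      integral_one_sub_pow_mul_overlapDist e hNM hj',
      integral_one_sub_pow_mul_overlapDist (e + 1) hNM hj']
    have := (overlapWeight_pos (j := j) e hNM).ne'
    field_simp
  have hexpand (j : ℕ) (hj : j ∈ range (N + 1)) :=
    sq_sub_div_overlapWeight e hNM (Nat.lt_succ_iff.1 (mem_range.1 hj))
  rw [hprior, sum_congr rfl hterm, ← mul_sum, sum_congr rfl hexpand, sum_add_distrib,
    sum_sub_distrib, ← sum_div, sum_sub_distrib, ← mul_sum, ← mul_sum, ← mul_sum,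
    sum_overlapWeight, sum_overlapWeight, sum_overlapWeight]
  push_cast
  field_simp
  ring
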